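/- For n even and noncrossing matchings a, b of type (n/2, n/2) (perfect noncrossing matchings on n points), the distance d(a,b) in the move graph equals n/2 − |aw(b)|, where |aw(b)| is the number of circles in the closed one-manifold obtained by gluing a to the reflection of b. -/

import Mathlib

/-- A noncrossing matching of type `(n-k, k)`: `k` pairwise-noncrossing arcs above a
horizontal line of `n` vertices (labelled `1,…,n`); the remaining `n-2k` vertices carry
rays, and no ray lies beneath an arc (every vertex strictly between the endpoints of an
arc is an endpoint of some arc). -/
structure NCMatching (n k : ℕ) where
  arcs : Finset (ℕ × ℕ)
  card_arcs : arcs.card = k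
  mem_range : ∀ p ∈ arcs, 1 ≤ p.1 ∧ p.1 < p.2 ∧ p.2 ≤ n
  endpoints_distinct : ∀ p ∈ arcs, ∀ q ∈ arcs, p ≠ q →
    p.1 ≠ q.1 ∧ p.1 ≠ q.2 ∧ p.2 ≠ q.1 ∧ p.2 ≠ q.2
  noncross : ∀ p ∈ arcs, ∀ q ∈ arcs, ¬ (p.1 < q.1 ∧ q.1 < p.2 ∧ p.2 < q.2)
  no_ray_under : ∀ p ∈ arcs, ∀ r, p.1 < r → r < p.2 → ∃ q ∈ arcs, r = q.1 ∨ r = q.2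

/-- Vertex `i` carries a ray of the matching `m`. -/
def NCMatching.IsRay {n k : ℕ} (m : NCMatching n k) (i : ℕ) : Prop :=
  1 ≤ i ∧ i ≤ n ∧ ∀ p ∈ m.arcs, p.1 ≠ i ∧ p.2 ≠ i

/-- The adjacency relation on vertices coming from the glued one-manifold `a w(b)`:
two vertices are related if an arc of `a` or an arc of (the reflection of) `b` joins them. -/
def glueRel {n k : ℕ} (a b : NCMatching n k) (i j : ℕ) : Prop :=
  (i, j) ∈ a.arcs ∨ (j, i) ∈ a.arcs ∨ (i, j) ∈ b.arcs ∨ (j, i) ∈ b.arcs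

/-- Two vertices lie on the same connected component of `a w(b)`. -/
def Conn {n k : ℕ} (a b : NCMatching n k) : ℕ → ℕ → Prop :=
  Relation.ReflTransGen (glueRel a b)

/-- The glue relation transported to `Fin n` (the vertex `i : Fin n` has label `i+1`). -/
def glueRelF {n k : ℕ} (a b : NCMatching n k) (i j : Fin n) : Prop :=
  glueRel a b ((i : ℕ) + 1) ((j : ℕ) + 1)

/-- `comps a b = |a w(b)|`, the number of connected components (circles and line
segments) of the glued one-manifold `a w(b)`. -/
noncomputable def comps {n k : ℕ} (a b : NCMatching n k) : ℕ :=
  Nat.card (Quot (glueRelF a b))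

/-- The elementary move `a → b`: either two unnested arcs `(i,j), (l,m)` of `a` are replaced
by the nested arcs `(i,m), (j,l)` on the same four vertices, or an arc-ray pair
`(i), (j,l)` with `i<j<l` is replaced by `(i,j), (l)`; the matchings agree elsewhere. -/
def Move {n k : ℕ} (a b : NCMatching n k) : Prop :=
  (∃ i j l m : ℕ, i < j ∧ j < l ∧ l < m ∧ (i, j) ∈ a.arcs ∧ (l, m) ∈ a.arcs ∧
    b.arcs = insert (i, m) (insert (j, l) ((a.arcs.erase (i, j)).erase (l, m)))) ∨
  (∃ i j l : ℕ, i < j ∧ j < l ∧ a.IsRay i ∧ (j, l) ∈ a.arcs ∧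
    b.arcs = insert (i, j) (a.arcs.erase (j, l)))

/-- A sequence of matchings in which each consecutive pair is related by `→` or `←`. -/
def IsMoveSeq {n k d : ℕ} (f : Fin (d + 1) → NCMatching n k) : Prop :=
  ∀ i : Fin d, Move (f i.castSucc) (f i.succ) ∨ Move (f i.succ) (f i.castSucc)

/-- The distance `d(a,b)`: the minimal number of moves `→` or `←` needed to go from `a` to `b`. -/
noncomputable def mdist {n k : ℕ} (a b : NCMatching n k) : ℕ :=
  sInf {d : ℕ | ∃ f : Fin (d + 1) → NCMatching n k,
    f 0 = a ∧ f (Fin.last d) = b ∧ IsMoveSeq f}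

theorem card_quot_le_card_quot_add_one {V : Type*} [Finite V] {r s : V → V → Prop} (x y : V)
    (h : ∀ u v, s u v → Relation.EqvGen (fun c d => r c d ∨ (c = x ∧ d = y)) u v) :
    Nat.card (Quot r) ≤ Nat.card (Quot s) + 1 := by
  classical
  set t : V → V → Prop := fun c d => r c d ∨ (c = x ∧ d = y)
  have hst : Nat.card (Quot t) ≤ Nat.card (Quot s) := by
    refine Nat.card_le_card_of_surjective
      (Quot.lift (fun v => Quot.mk t v) fun u v huv => Quot.eqvGen_sound (h u v huv)) ?_
    rintro ⟨v⟩
    exact ⟨Quot.mk s v, rfl⟩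
  let g : Quot t → Quot r :=
    Quot.lift (fun v => if Quot.mk r v = Quot.mk r x then Quot.mk r y else Quot.mk r v) (by
      rintro u v (huv | ⟨rfl, rfl⟩)
      · simp only [Quot.sound huv]
      · simp)
  let g' : Option (Quot t) → Quot r := fun o => o.elim (Quot.mk r x) g
  have hg' : Function.Surjective g' := by
    rintro ⟨v⟩
    by_cases hv : Quot.mk r v = Quot.mk r x
    · exact ⟨none, hv.symm⟩
    · exact ⟨some (Quot.mk t v), if_neg hv⟩
  have hrt := Nat.card_le_card_of_surjective g' hg'
  rw [Finite.card_option] at hrt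
  omega

theorem card_quot_lt_card_quot {V : Type*} [Finite V] {r s : V → V → Prop} {x y : V}
    (h : ∀ u v, s u v → Relation.EqvGen r u v) (hr : Relation.EqvGen r x y)
    (hs : ¬ Relation.EqvGen s x y) : Nat.card (Quot r) < Nat.card (Quot s) := by
  let g : Quot s → Quot r :=
    Quot.lift (fun v => Quot.mk r v) fun u v huv => Quot.eqvGen_sound (h u v huv)
  have hg : Function.Surjective g := by
    rintro ⟨v⟩
    exact ⟨Quot.mk s v, rfl⟩
  refine lt_of_le_of_ne (Nat.card_le_card_of_surjective g hg) fun hcard => hs ?_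
  have hbij := (Nat.bijective_iff_surjective_and_card g).2 ⟨hg, hcard.symm⟩
  exact Quot.eqvGen_exact (hbij.1 (a₁ := Quot.mk s x) (a₂ := Quot.mk s y) (Quot.eqvGen_sound hr))

namespace NCMatching

theorem eq_of_common_vertex {n k : ℕ} (a : NCMatching n k) {p q : ℕ × ℕ} (hp : p ∈ a.arcs)
    (hq : q ∈ a.arcs) {v : ℕ} (hvp : v = p.1 ∨ v = p.2) (hvq : v = q.1 ∨ v = q.2) : p = q := by
  by_contra hne
  have := a.endpoints_distinct p hp q hq hne
  omega

theorem exists_arc {m : ℕ} (a : NCMatching (2 * m) m) {v : ℕ} (h1 : 1 ≤ v) (h2 : v ≤ 2 * m) :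
    ∃ p ∈ a.arcs, v = p.1 ∨ v = p.2 := by
  have hfst : (a.arcs.image Prod.fst).card = m := by
    rw [Finset.card_image_of_injOn, a.card_arcs]
    intro p hp q hq hpq
    exact a.eq_of_common_vertex hp hq (Or.inl rfl) (Or.inl hpq)
  have hsnd : (a.arcs.image Prod.snd).card = m := by
    rw [Finset.card_image_of_injOn, a.card_arcs]
    intro p hp q hq hpq
    exact a.eq_of_common_vertex hp hq (Or.inr rfl) (Or.inr hpq)
  have hdisj : Disjoint (a.arcs.image Prod.fst) (a.arcs.image Prod.snd) := by
    rw [Finset.disjoint_left]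
    intro w hw hw'
    obtain ⟨p, hp, rfl⟩ := Finset.mem_image.1 hw
    obtain ⟨q, hq, hqp⟩ := Finset.mem_image.1 hw'
    have := a.eq_of_common_vertex hp hq (Or.inl rfl) (Or.inr hqp.symm)
    have := a.mem_range p hp
    subst q
    omega
  have hunion : a.arcs.image Prod.fst ∪ a.arcs.image Prod.snd = Finset.Icc 1 (2 * m) := by
    refine Finset.eq_of_subset_of_card_le ?_ ?_
    · intro w hw
      rw [Finset.mem_union, Finset.mem_image, Finset.mem_image] at hw
      rw [Finset.mem_Icc]
      rcases hw with ⟨p, hp, rfl⟩ | ⟨p, hp, rfl⟩ <;>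
      · have := a.mem_range p hp
        omega
    · rw [Finset.card_union_of_disjoint hdisj, hfst, hsnd, Nat.card_Icc]
      omega
  have hv : v ∈ a.arcs.image Prod.fst ∪ a.arcs.image Prod.snd := by
    rw [hunion, Finset.mem_Icc]
    exact ⟨h1, h2⟩
  rw [Finset.mem_union, Finset.mem_image, Finset.mem_image] at hv
  rcases hv with ⟨p, hp, rfl⟩ | ⟨p, hp, rfl⟩
  · exact ⟨p, hp, Or.inl rfl⟩
  · exact ⟨p, hp, Or.inr rfl⟩

theorem not_isRay {m : ℕ} (a : NCMatching (2 * m) m) (v : ℕ) : ¬ a.IsRay v := by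
  rintro ⟨h1, h2, h⟩
  obtain ⟨p, hp, hv⟩ := a.exists_arc h1 h2
  have := h p hp
  omega

theorem ext_arcs {n k : ℕ} {a b : NCMatching n k} (h : a.arcs = b.arcs) : a = b := by
  cases a
  cases b
  cases h
  rfl

/-- Two arcs cross when exactly one endpoint of the second lies under the first. -/
def Crossing (p q : ℕ × ℕ) : Prop :=
  (p.1 < q.1 ∧ q.1 < p.2 ∧ p.2 < q.2) ∨ (q.1 < p.1 ∧ p.1 < q.2 ∧ q.2 < p.2)

theorem exists_swap {m : ℕ} (a : NCMatching (2 * m) m) {g h e f : ℕ × ℕ} (hg : g ∈ a.arcs)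
    (hh : h ∈ a.arcs) (hgh : g ≠ h) (he : e.1 < e.2) (hf : f.1 < f.2)
    (hef : e.1 ≠ f.1 ∧ e.1 ≠ f.2 ∧ e.2 ≠ f.1 ∧ e.2 ≠ f.2)
    (hV : ∀ v, (v = e.1 ∨ v = e.2 ∨ v = f.1 ∨ v = f.2) ↔ (v = g.1 ∨ v = g.2 ∨ v = h.1 ∨ v = h.2))
    (hcross : ¬ Crossing e f)
    (hc : ∀ p ∈ a.arcs, p ≠ g → p ≠ h → ¬ Crossing p e ∧ ¬ Crossing p f) :
    ∃ a' : NCMatching (2 * m) m,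
      a'.arcs = insert e (insert f ((a.arcs.erase g).erase h)) := by
  have hgr := a.mem_range g hg
  have hhr := a.mem_range h hh
  have hrange : ∀ v, (v = e.1 ∨ v = e.2 ∨ v = f.1 ∨ v = f.2) → 1 ≤ v ∧ v ≤ 2 * m := by
    intro v hv
    have := (hV v).1 hv
    omega
  have hoff : ∀ p ∈ a.arcs, p ≠ g → p ≠ h →
      ∀ v, (v = e.1 ∨ v = e.2 ∨ v = f.1 ∨ v = f.2) → p.1 ≠ v ∧ p.2 ≠ v := by
    intro p hp hpg hph v hv
    have h1 := (hV v).1 hv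
    have h2 := a.endpoints_distinct p hp g hg hpg
    have h3 := a.endpoints_distinct p hp h hh hph
    omega
  have hmem : ∀ p, p ∈ insert e (insert f ((a.arcs.erase g).erase h)) ↔
      p = e ∨ p = f ∨ (p ≠ h ∧ p ≠ g ∧ p ∈ a.arcs) := by
    intro p
    simp only [Finset.mem_insert, Finset.mem_erase]
  have hdist : ∀ p ∈ a.arcs, p ≠ g → p ≠ h →
      (p.1 ≠ e.1 ∧ p.1 ≠ e.2 ∧ p.2 ≠ e.1 ∧ p.2 ≠ e.2) ∧
      (p.1 ≠ f.1 ∧ p.1 ≠ f.2 ∧ p.2 ≠ f.1 ∧ p.2 ≠ f.2) := by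
    intro p hp hpg hph
    have h1 := hoff p hp hpg hph e.1 (by simp)
    have h2 := hoff p hp hpg hph e.2 (by simp)
    have h3 := hoff p hp hpg hph f.1 (by simp)
    have h4 := hoff p hp hpg hph f.2 (by simp)
    omega
  have hcover : ∀ r, 1 ≤ r → r ≤ 2 * m →
      ∃ q ∈ insert e (insert f ((a.arcs.erase g).erase h)), r = q.1 ∨ r = q.2 := by
    intro r hr1 hr2
    by_cases hr : r = e.1 ∨ r = e.2 ∨ r = f.1 ∨ r = f.2
    · rcases hr with hr | hr | hr | hr
      · exact ⟨e, by simp, Or.inl hr⟩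
      · exact ⟨e, by simp, Or.inr hr⟩
      · exact ⟨f, by simp, Or.inl hr⟩
      · exact ⟨f, by simp, Or.inr hr⟩
    · rw [hV] at hr
      obtain ⟨q, hq, hrq⟩ := a.exists_arc hr1 hr2
      refine ⟨q, (hmem q).2 (Or.inr (Or.inr ⟨?_, ?_, hq⟩)), hrq⟩
      · rintro rfl
        omega
      · rintro rfl
        omega
  have hrange' : ∀ p ∈ insert e (insert f ((a.arcs.erase g).erase h)),
      1 ≤ p.1 ∧ p.1 < p.2 ∧ p.2 ≤ 2 * m := by
    intro p hp
    rcases (hmem p).1 hp with rfl | rfl | ⟨-, -, hp⟩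
    · exact ⟨(hrange _ (by simp)).1, he, (hrange _ (by simp)).2⟩
    · exact ⟨(hrange _ (by simp)).1, hf, (hrange _ (by simp)).2⟩
    · exact a.mem_range p hp
  refine ⟨⟨_, ?_, hrange', ?_, ?_, ?_⟩, rfl⟩
  · have hfn : f ∉ (a.arcs.erase g).erase h := by
      simp only [Finset.mem_erase, not_and]
      intro h1 h2 h3
      exact (hdist f h3 h2 h1).2.1 rfl
    have hen : e ∉ insert f ((a.arcs.erase g).erase h) := by
      simp only [Finset.mem_insert, Finset.mem_erase, not_or, not_and]
      refine ⟨fun h1 => hef.1 (by rw [h1]), fun h1 h2 h3 => (hdist e h3 h2 h1).1.1 rfl⟩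
    have hcard : 1 < a.arcs.card := Finset.one_lt_card.2 ⟨g, hg, h, hh, hgh⟩
    rw [Finset.card_insert_of_notMem hen, Finset.card_insert_of_notMem hfn,
      Finset.card_erase_of_mem (Finset.mem_erase.2 ⟨hgh.symm, hh⟩), Finset.card_erase_of_mem hg]
    have := a.card_arcs
    omega
  · intro p hp q hq hpq
    rcases (hmem p).1 hp with rfl | rfl | ⟨hph, hpg, hpa⟩ <;>
    rcases (hmem q).1 hq with rfl | rfl | ⟨hqh, hqg, hq⟩
    · exact absurd rfl hpq
    · exact hef
    · have := hdist q hq hqg hqh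
      omega
    · omega
    · exact absurd rfl hpq
    · have := hdist q hq hqg hqh
      omega
    · exact (hdist p hpa hpg hph).1
    · exact (hdist p hpa hpg hph).2
    · exact a.endpoints_distinct p hpa q hq hpq
  · intro p hp q hq
    unfold Crossing at hc hcross
    rcases (hmem p).1 hp with rfl | rfl | ⟨hph, hpg, hpa⟩ <;>
    rcases (hmem q).1 hq with rfl | rfl | ⟨hqh, hqg, hq⟩
    · omega
    · omega
    · have := hc q hq hqg hqh
      omega
    · omega
    · omega
    · have := hc q hq hqg hqh
      omega
    · have := hc p hpa hpg hph
      omega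
    · have := hc p hpa hpg hph
      omega
    · exact a.noncross p hpa q hq
  · intro p hp r hr1 hr2
    have := hrange' p hp
    exact hcover r (by omega) (by omega)

theorem exists_innermost_arc {m : ℕ} {a b : NCMatching (2 * m) m} (hab : a ≠ b) :
    ∃ p q, (p, q) ∈ b.arcs ∧ (p, q) ∉ a.arcs ∧
      ∀ x ∈ a.arcs, (p < x.1 ∧ x.1 < q) ↔ (p < x.2 ∧ x.2 < q) := by
  have hne : (b.arcs \ a.arcs).Nonempty := by
    rw [Finset.sdiff_nonempty]
    intro hsub
    exact hab (ext_arcs (Finset.eq_of_subset_of_card_le hsub (by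
      rw [a.card_arcs, b.card_arcs])).symm)
  obtain ⟨⟨p, q⟩, hpq, hmin⟩ := Finset.exists_min_image _ (fun x : ℕ × ℕ => x.2 - x.1) hne
  rw [Finset.mem_sdiff] at hpq
  refine ⟨p, q, hpq.1, hpq.2, ?_⟩
  have key : ∀ x ∈ a.arcs, ∀ v, (v = x.1 ∨ v = x.2) → p < v → v < q →
      p < x.1 ∧ x.1 < q ∧ p < x.2 ∧ x.2 < q := by
    intro x hx v hv h1 h2
    obtain ⟨y, hy, hvy⟩ := b.no_ray_under _ hpq.1 v h1 h2
    have hyne : y ≠ (p, q) := by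
      rintro rfl
      dsimp only at hvy
      omega
    have hd := b.endpoints_distinct y hy _ hpq.1 hyne
    have hc1 := b.noncross y hy _ hpq.1
    have hc2 := b.noncross _ hpq.1 y hy
    have hyr := b.mem_range y hy
    dsimp only at hd hc1 hc2
    have hya : y ∈ a.arcs := by
      by_contra hya
      have := hmin y (Finset.mem_sdiff.2 ⟨hy, hya⟩)
      dsimp only at this
      omega
    obtain rfl := a.eq_of_common_vertex hx hya hv hvy
    omega
  intro x hx
  constructor
  · rintro ⟨h1, h2⟩
    exact (key x hx x.1 (Or.inl rfl) h1 h2).2.2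
  · rintro ⟨h1, h2⟩
    have := key x hx x.2 (Or.inr rfl) h1 h2
    exact ⟨this.1, this.2.1⟩

/-- Whenever `a ≠ b`, some move takes `a` to a matching sharing an additional arc `(p, q)` with
`b`; the move acts on the arcs `(p, p')` and `(q, q')` of `a`, up to orientation. -/
theorem exists_move_toward {m : ℕ} {a b : NCMatching (2 * m) m} (hab : a ≠ b) :
    ∃ (a' : NCMatching (2 * m) m) (p q : ℕ) (g h f : ℕ × ℕ),
      (Move a a' ∨ Move a' a) ∧ (p, q) ∈ b.arcs ∧ (p, q) ∉ a.arcs ∧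
      g ∈ a.arcs ∧ h ∈ a.arcs ∧ (p = g.1 ∨ p = g.2) ∧ (q = h.1 ∨ q = h.2) ∧
      (∀ v, (v = p ∨ v = q ∨ v = f.1 ∨ v = f.2) ↔ (v = g.1 ∨ v = g.2 ∨ v = h.1 ∨ v = h.2)) ∧
      a'.arcs = insert (p, q) (insert f ((a.arcs.erase g).erase h)) := by
  obtain ⟨p, q, hb, hna, hin⟩ := exists_innermost_arc hab
  have hpq := b.mem_range _ hb
  dsimp only at hpq
  obtain ⟨g, hg, hpg⟩ := a.exists_arc (v := p) (by omega) (by omega)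
  obtain ⟨h, hh, hqh⟩ := a.exists_arc (v := q) (by omega) (by omega)
  have hgr := a.mem_range g hg
  have hhr := a.mem_range h hh
  have hgin := hin g hg
  have hhin := hin h hh
  have hgh : g ≠ h := by
    rintro rfl
    apply hna
    have : g = (p, q) := Prod.ext (by dsimp only; omega) (by dsimp only; omega)
    rwa [← this]
  have hd := a.endpoints_distinct g hg h hh hgh
  have hn1 := a.noncross g hg h hh
  have hn2 := a.noncross h hh g hg
  obtain ⟨g1, g2⟩ := g
  obtain ⟨h1, h2⟩ := h
  dsimp only at *
  have hswap : ∀ f : ℕ × ℕ, f.1 < f.2 →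
      (f = (g1, h2) ∧ p = g2 ∧ q = h1 ∨ f = (h1, g1) ∧ p = g2 ∧ q = h2 ∨
        f = (h2, g2) ∧ p = g1 ∧ q = h1) →
      ∃ a' : NCMatching (2 * m) m,
        a'.arcs = insert (p, q) (insert f ((a.arcs.erase (g1, g2)).erase (h1, h2))) := by
    intro f hf hcases
    refine a.exists_swap hg hh hgh hpq.2.1 hf ?_ ?_ ?_ ?_
    · rcases hcases with ⟨rfl, rfl, rfl⟩ | ⟨rfl, rfl, rfl⟩ | ⟨rfl, rfl, rfl⟩ <;>
        dsimp only at * <;> omega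
    · intro v
      rcases hcases with ⟨rfl, rfl, rfl⟩ | ⟨rfl, rfl, rfl⟩ | ⟨rfl, rfl, rfl⟩ <;>
        dsimp only at * <;> omega
    · unfold Crossing
      rcases hcases with ⟨rfl, rfl, rfl⟩ | ⟨rfl, rfl, rfl⟩ | ⟨rfl, rfl, rfl⟩ <;>
        dsimp only at * <;> omega
    · intro x hx hxg hxh
      have hxr := a.mem_range x hx
      have e1 := a.endpoints_distinct x hx _ hg hxg
      have e2 := a.endpoints_distinct x hx _ hh hxh
      have c1 := a.noncross x hx _ hg
      have c2 := a.noncross _ hg x hx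
      have c3 := a.noncross x hx _ hh
      have c4 := a.noncross _ hh x hx
      have c5 := hin x hx
      unfold Crossing
      rcases hcases with ⟨rfl, rfl, rfl⟩ | ⟨rfl, rfl, rfl⟩ | ⟨rfl, rfl, rfl⟩ <;>
        dsimp only at * <;> constructor <;> omega
  have hnotin : ∀ e : ℕ × ℕ, (e.1 = g1 ∨ e.1 = g2 ∨ e.1 = h1 ∨ e.1 = h2) →
      e ≠ (g1, g2) → e ≠ (h1, h2) → e ∉ a.arcs := by
    intro e he heg heh hea
    rcases he with he | he | he | he
    · exact heg (a.eq_of_common_vertex hea hg (Or.inl rfl) (Or.inl he))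
    · exact heg (a.eq_of_common_vertex hea hg (Or.inl rfl) (Or.inr he))
    · exact heh (a.eq_of_common_vertex hea hh (Or.inl rfl) (Or.inl he))
    · exact heh (a.eq_of_common_vertex hea hh (Or.inl rfl) (Or.inr he))
  rcases hpg with rfl | rfl <;> rcases hqh with rfl | rfl
  · obtain ⟨a', ha'⟩ := hswap (h2, g2) (by dsimp only; omega) (by simp)
    refine ⟨a', p, q, _, _, _, Or.inr (Or.inl ⟨p, q, h2, g2, ?_, ?_, ?_, ?_, ?_, ?_⟩), hb, hna,
      hg, hh, by simp, by simp, fun v => by dsimp only; omega, ha'⟩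
    · omega
    · omega
    · omega
    · simp [ha']
    · simp [ha']
    · have n1 := hnotin (h2, g2) (by simp) (by simp; omega) (by simp; omega)
      ext x
      simp only [ha', Finset.mem_insert, Finset.mem_erase]
      grind
  · omega
  · obtain ⟨a', ha'⟩ := hswap (g1, h2) (by dsimp only; omega) (by simp)
    refine ⟨a', p, q, _, _, _, Or.inl (Or.inl ⟨g1, p, q, h2, ?_, ?_, ?_, hg, hh, ?_⟩), hb, hna,
      hg, hh, by simp, by simp, fun v => by dsimp only; omega, ha'⟩
    · omega
    · omega
    · omega
    · rw [ha', Finset.insert_comm]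
  · obtain ⟨a', ha'⟩ := hswap (h1, g1) (by dsimp only; omega) (by simp)
    refine ⟨a', p, q, _, _, _, Or.inr (Or.inl ⟨h1, g1, p, q, ?_, ?_, ?_, ?_, ?_, ?_⟩), hb, hna,
      hg, hh, by simp, by simp, fun v => by dsimp only; omega, ha'⟩
    · omega
    · omega
    · omega
    · simp [ha']
    · simp [ha']
    · have n1 := hnotin (h1, g1) (by simp) (by simp; omega) (by simp; omega)
      ext x
      simp only [ha', Finset.mem_insert, Finset.mem_erase]
      grind

theorem exists_fin_of_mem {n k : ℕ} (a : NCMatching n k) {p : ℕ × ℕ} (hp : p ∈ a.arcs) :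
    ∃ x y : Fin n, p = ((x : ℕ) + 1, (y : ℕ) + 1) := by
  have := a.mem_range p hp
  exact ⟨⟨p.1 - 1, by omega⟩, ⟨p.2 - 1, by omega⟩,
    Prod.ext (by dsimp only; omega) (by dsimp only; omega)⟩

end NCMatching

theorem comps_self {m : ℕ} (a : NCMatching (2 * m) m) : comps a a = m := by
  have hex : ∀ v : Fin (2 * m), ∃ p : a.arcs, (v : ℕ) + 1 = p.1.1 ∨ (v : ℕ) + 1 = p.1.2 := by
    intro v
    obtain ⟨p, hp, hv⟩ := a.exists_arc (v := (v : ℕ) + 1) (by omega) (by omega)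
    exact ⟨⟨p, hp⟩, hv⟩
  choose arc harc using hex
  have hrel : ∀ u v, glueRelF a a u v → arc u = arc v := by
    intro u v huv
    have huv' : ((u : ℕ) + 1, (v : ℕ) + 1) ∈ a.arcs ∨ ((v : ℕ) + 1, (u : ℕ) + 1) ∈ a.arcs := by
      unfold glueRelF glueRel at huv
      tauto
    refine Subtype.ext ?_
    rcases huv' with h | h
    · rw [a.eq_of_common_vertex (arc u).2 h (harc u) (Or.inl rfl),
        a.eq_of_common_vertex (arc v).2 h (harc v) (Or.inr rfl)]
    · rw [a.eq_of_common_vertex (arc u).2 h (harc u) (Or.inr rfl),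
        a.eq_of_common_vertex (arc v).2 h (harc v) (Or.inl rfl)]
  have hbij : Function.Bijective (Quot.lift arc hrel) := by
    constructor
    · rintro ⟨u⟩ ⟨v⟩ (huv : arc u = arc v)
      have hu := harc u
      have hv := harc v
      rw [← huv] at hv
      by_cases he : u = v
      · rw [he]
      · refine Quot.sound ?_
        have he' : (u : ℕ) ≠ v := fun h => he (Fin.ext h)
        have hmem := (arc u).2
        rcases hu with hu | hu <;> rcases hv with hv | hv
        · omega
        · exact Or.inl (by rw [hu, hv]; exact hmem)
        · exact Or.inr (Or.inl (by rw [hu, hv]; exact hmem))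
        · omega
    · rintro ⟨p, hp⟩
      obtain ⟨x, y, rfl⟩ := a.exists_fin_of_mem hp
      exact ⟨Quot.mk _ x, Subtype.ext
        (a.eq_of_common_vertex (arc x).2 hp (harc x) (Or.inl rfl))⟩
  rw [comps, Nat.card_congr (Equiv.ofBijective _ hbij), Nat.card_eq_fintype_card,
    Fintype.card_coe, a.card_arcs]

theorem Move.comps_le {m : ℕ} {a a' : NCMatching (2 * m) m} (h : Move a a')
    (c : NCMatching (2 * m) m) : comps a c ≤ comps a' c + 1 ∧ comps a' c ≤ comps a c + 1 := by
  rcases h with ⟨i, j, l, k, hij, hjl, hlk, h1, h2, ha'⟩ | ⟨i, _, _, _, _, hi, _⟩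
  swap
  · exact absurd hi (a.not_isRay i)
  obtain ⟨i, j, he⟩ := a.exists_fin_of_mem h1
  obtain ⟨rfl, rfl⟩ := Prod.mk.inj he
  obtain ⟨l, k, he⟩ := a.exists_fin_of_mem h2
  obtain ⟨rfl, rfl⟩ := Prod.mk.inj he
  have hcongr : ∀ {x y u v : Fin (2 * m)}, ((u : ℕ) + 1, (v : ℕ) + 1) = ((x : ℕ) + 1, (y : ℕ) + 1) →
      u = x ∧ v = y := by
    intro x y u v h
    rw [Prod.mk.injEq] at h
    exact ⟨Fin.ext (by omega), Fin.ext (by omega)⟩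
  constructor
  · refine card_quot_le_card_quot_add_one i k fun u v huv => ?_
    set t : Fin (2 * m) → Fin (2 * m) → Prop :=
      fun x y => glueRelF a c x y ∨ (x = i ∧ y = k)
    have hik : Relation.EqvGen t i k := .rel _ _ (Or.inr ⟨rfl, rfl⟩)
    have hij' : Relation.EqvGen t i j := .rel _ _ (Or.inl (Or.inl h1))
    have hlk' : Relation.EqvGen t l k := .rel _ _ (Or.inl (Or.inl h2))
    have hjl' : Relation.EqvGen t j l := (hij'.symm.trans _ _ _ hik).trans _ _ _ hlk'.symm
    have key : ∀ {u v : Fin (2 * m)}, ((u : ℕ) + 1, (v : ℕ) + 1) ∈ a'.arcs →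
        Relation.EqvGen t u v := by
      intro u v huv
      rw [ha', Finset.mem_insert, Finset.mem_insert, Finset.mem_erase, Finset.mem_erase] at huv
      rcases huv with h | h | ⟨-, -, h⟩
      · obtain ⟨rfl, rfl⟩ := hcongr h
        exact hik
      · obtain ⟨rfl, rfl⟩ := hcongr h
        exact hjl'
      · exact .rel _ _ (Or.inl (Or.inl h))
    rcases huv with h | h | h | h
    · exact key h
    · exact (key h).symm
    · exact .rel _ _ (Or.inl (Or.inr (Or.inr (Or.inl h))))
    · exact .rel _ _ (Or.inl (Or.inr (Or.inr (Or.inr h))))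
  · refine card_quot_le_card_quot_add_one i j fun u v huv => ?_
    set t : Fin (2 * m) → Fin (2 * m) → Prop :=
      fun x y => glueRelF a' c x y ∨ (x = i ∧ y = j)
    have hij' : Relation.EqvGen t i j := .rel _ _ (Or.inr ⟨rfl, rfl⟩)
    have hik : Relation.EqvGen t i k := .rel _ _ (Or.inl (Or.inl (by simp [ha'])))
    have hjl' : Relation.EqvGen t j l := .rel _ _ (Or.inl (Or.inl (by simp [ha'])))
    have hlk' : Relation.EqvGen t l k := (hjl'.symm.trans _ _ _ hij'.symm).trans _ _ _ hik
    have key : ∀ {u v : Fin (2 * m)}, ((u : ℕ) + 1, (v : ℕ) + 1) ∈ a.arcs →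
        Relation.EqvGen t u v := by
      intro u v huv
      by_cases he1 : ((u : ℕ) + 1, (v : ℕ) + 1) = ((i : ℕ) + 1, (j : ℕ) + 1)
      · obtain ⟨rfl, rfl⟩ := hcongr he1
        exact hij'
      by_cases he2 : ((u : ℕ) + 1, (v : ℕ) + 1) = ((l : ℕ) + 1, (k : ℕ) + 1)
      · obtain ⟨rfl, rfl⟩ := hcongr he2
        exact hlk'
      refine .rel _ _ (Or.inl (Or.inl ?_))
      rw [ha', Finset.mem_insert, Finset.mem_insert, Finset.mem_erase, Finset.mem_erase]
      exact Or.inr (Or.inr ⟨he2, he1, huv⟩)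
    rcases huv with h | h | h | h
    · exact key h
    · exact (key h).symm
    · exact .rel _ _ (Or.inl (Or.inr (Or.inr (Or.inl h))))
    · exact .rel _ _ (Or.inl (Or.inr (Or.inr (Or.inr h))))

/-- An arc common to `a` and `b` is a connected component of `a w(b)`. -/
theorem eqvGen_glueRelF_iff {n k : ℕ} {a b : NCMatching n k} {p q : ℕ} (ha : (p, q) ∈ a.arcs)
    (hb : (p, q) ∈ b.arcs) {u v : Fin n} (huv : Relation.EqvGen (glueRelF a b) u v) :
    ((u : ℕ) + 1 = p ∨ (u : ℕ) + 1 = q) ↔ ((v : ℕ) + 1 = p ∨ (v : ℕ) + 1 = q) := by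
  have key : ∀ (c : NCMatching n k), (p, q) ∈ c.arcs → ∀ x y, (x, y) ∈ c.arcs →
      ((x = p ∨ x = q) ↔ (y = p ∨ y = q)) := by
    intro c hc x y hxy
    by_cases he : (x, y) = (p, q)
    · obtain ⟨rfl, rfl⟩ := Prod.mk.inj he
      simp
    · have := c.endpoints_distinct _ hxy _ hc he
      dsimp only at this
      omega
  induction huv with
  | rel u v h =>
    rcases h with h | h | h | h
    · exact key a ha _ _ h
    · exact (key a ha _ _ h).symm
    · exact key b hb _ _ h
    · exact (key b hb _ _ h).symm
  | refl => rfl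
  | symm _ _ _ ih => exact ih.symm
  | trans _ _ _ _ _ ih1 ih2 => exact ih1.trans ih2

theorem exists_move_comps_lt {m : ℕ} {a b : NCMatching (2 * m) m} (hab : a ≠ b) :
    ∃ a' : NCMatching (2 * m) m, (Move a a' ∨ Move a' a) ∧ comps a b < comps a' b ∧
      (b.arcs \ a'.arcs).card < (b.arcs \ a.arcs).card := by
  obtain ⟨a', p, q, g, h, f, hmove, hb, hna, hg, hh, hpg, hqh, hV, ha'⟩ :=
    NCMatching.exists_move_toward hab
  have hpa' : (p, q) ∈ a'.arcs := by simp [ha']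
  have hfa' : f ∈ a'.arcs := by simp [ha']
  have hgb : g ∉ b.arcs := by
    intro hgb
    have := b.eq_of_common_vertex hgb hb hpg (Or.inl rfl)
    exact hna (this ▸ hg)
  have hhb : h ∉ b.arcs := by
    intro hhb
    have := b.eq_of_common_vertex hhb hb hqh (Or.inr rfl)
    exact hna (this ▸ hh)
  refine ⟨a', hmove, ?_, ?_⟩
  · obtain ⟨p, q, he⟩ := b.exists_fin_of_mem hb
    obtain ⟨rfl, rfl⟩ := Prod.mk.inj he
    obtain ⟨x, y, rfl⟩ := a'.exists_fin_of_mem hfa'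
    obtain ⟨g1, g2, rfl⟩ := a.exists_fin_of_mem hg
    obtain ⟨h1, h2, rfl⟩ := a.exists_fin_of_mem hh
    dsimp only at *
    have hconn : ∀ v : Fin (2 * m), (v = g1 ∨ v = g2 ∨ v = h1 ∨ v = h2) →
        Relation.EqvGen (glueRelF a b) p v := by
      have hg' : Relation.EqvGen (glueRelF a b) g1 g2 := .rel _ _ (Or.inl hg)
      have hh' : Relation.EqvGen (glueRelF a b) h1 h2 := .rel _ _ (Or.inl hh)
      have hpq : Relation.EqvGen (glueRelF a b) p q := .rel _ _ (Or.inr (Or.inr (Or.inl hb)))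
      have hpg' : p = g1 ∨ p = g2 := by
        simpa [Fin.ext_iff] using hpg
      have hqh' : q = h1 ∨ q = h2 := by
        simpa [Fin.ext_iff] using hqh
      rintro v (rfl | rfl | rfl | rfl)
      · rcases hpg' with rfl | rfl
        · exact .refl _
        · exact hg'.symm
      · rcases hpg' with rfl | rfl
        · exact hg'
        · exact .refl _
      · rcases hqh' with rfl | rfl
        · exact hpq
        · exact hpq.trans _ _ _ hh'.symm
      · rcases hqh' with rfl | rfl
        · exact hpq.trans _ _ _ hh'
        · exact hpq
    have hV' : ∀ v : Fin (2 * m), (v = p ∨ v = q ∨ v = x ∨ v = y) →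
        Relation.EqvGen (glueRelF a b) p v := by
      intro v hv
      refine hconn v ?_
      have := hV ((v : ℕ) + 1)
      simp only [Fin.ext_iff] at hv ⊢
      omega
    have key : ∀ {u v : Fin (2 * m)}, ((u : ℕ) + 1, (v : ℕ) + 1) ∈ a'.arcs →
        Relation.EqvGen (glueRelF a b) u v := by
      intro u v huv
      rw [ha', Finset.mem_insert, Finset.mem_insert, Finset.mem_erase, Finset.mem_erase,
        Prod.mk.injEq, Prod.mk.injEq] at huv
      rcases huv with h | h | ⟨-, -, h⟩
      · exact (hV' u (by simp only [Fin.ext_iff]; omega)).symm.trans _ _ _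
          (hV' v (by simp only [Fin.ext_iff]; omega))
      · exact (hV' u (by simp only [Fin.ext_iff]; omega)).symm.trans _ _ _
          (hV' v (by simp only [Fin.ext_iff]; omega))
      · exact .rel _ _ (Or.inl h)
    refine card_quot_lt_card_quot (x := p) (y := x) ?_ (hV' x (by simp)) ?_
    · intro u v huv
      rcases huv with h | h | h | h
      · exact key h
      · exact (key h).symm
      · exact .rel _ _ (Or.inr (Or.inr (Or.inl h)))
      · exact .rel _ _ (Or.inr (Or.inr (Or.inr h)))
    · intro hpx
      have hx := (eqvGen_glueRelF_iff hpa' hb hpx).1 (Or.inl rfl)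
      have hfe := a'.eq_of_common_vertex hfa' hpa' (Or.inl rfl) hx
      rw [Prod.mk.injEq] at hfe
      have hgr := a.mem_range _ hg
      have hd := a.endpoints_distinct _ hg _ hh (by
        intro heq
        rw [Prod.mk.injEq] at heq
        apply hna
        have := b.mem_range _ hb
        have e : ((p : ℕ) + 1, (q : ℕ) + 1) = ((g1 : ℕ) + 1, (g2 : ℕ) + 1) := by
          rw [Prod.mk.injEq]
          dsimp only at this
          omega
        rw [e]
        exact hg)
      have v1 := hV ((g1 : ℕ) + 1)
      have v2 := hV ((g2 : ℕ) + 1)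
      have v3 := hV ((h1 : ℕ) + 1)
      dsimp only at hd hgr
      omega
  · refine Finset.card_lt_card (Finset.ssubset_iff_of_subset ?_ |>.2
      ⟨(p, q), Finset.mem_sdiff.2 ⟨hb, hna⟩, fun hmem => (Finset.mem_sdiff.1 hmem).2 hpa'⟩)
    intro z hz
    rw [Finset.mem_sdiff] at hz ⊢
    refine ⟨hz.1, fun hza => hz.2 ?_⟩
    rw [ha', Finset.mem_insert, Finset.mem_insert, Finset.mem_erase, Finset.mem_erase]
    refine Or.inr (Or.inr ⟨?_, ?_, hza⟩)
    · rintro rfl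
      exact hhb hz.1
    · rintro rfl
      exact hgb hz.1

theorem exists_moveSeq {m : ℕ} (a b : NCMatching (2 * m) m) :
    ∃ d, d + comps a b ≤ m ∧ ∃ f : Fin (d + 1) → NCMatching (2 * m) m,
      f 0 = a ∧ f (Fin.last d) = b ∧ IsMoveSeq f := by
  induction hN : (b.arcs \ a.arcs).card using Nat.strong_induction_on generalizing a with
  | _ N ih =>
    by_cases hab : a = b
    · subst hab
      exact ⟨0, by rw [comps_self, zero_add], fun _ => a, rfl, rfl, fun i => i.elim0⟩
    · obtain ⟨a', hmove, hcomps, hcard⟩ := exists_move_comps_lt hab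
      obtain ⟨d, hd, f, hf0, hfl, hf⟩ := ih _ (hN ▸ hcard) a' rfl
      refine ⟨d + 1, by omega, Fin.cons a f, rfl, ?_, ?_⟩
      · rw [← Fin.succ_last, Fin.cons_succ, hfl]
      · intro i
        refine Fin.cases ?_ (fun i => ?_) i
        · rw [Fin.castSucc_zero, Fin.cons_zero, Fin.cons_succ, hf0]
          exact hmove
        · rw [Fin.castSucc_succ, Fin.cons_succ, Fin.cons_succ]
          exact hf i

theorem IsMoveSeq.comps_le {m d : ℕ} {f : Fin (d + 1) → NCMatching (2 * m) m} (hf : IsMoveSeq f)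
    (c : NCMatching (2 * m) m) (i : Fin (d + 1)) : comps (f i) c ≤ comps (f 0) c + i := by
  induction i using Fin.induction with
  | zero => simp
  | succ i ih =>
    have hstep : comps (f i.succ) c ≤ comps (f i.castSucc) c + 1 := by
      rcases hf i with h | h
      · exact (h.comps_le c).2
      · exact (h.comps_le c).1
    rw [Fin.val_castSucc] at ih
    rw [Fin.val_succ]
    omega

/-- For perfect noncrossing matchings `a, b` on `n = 2m` points (type `(n/2, n/2)`),
the distance in the move graph satisfies `d(a,b) = n/2 - |a w(b)|`, where `|a w(b)|`
is the number of circles of the glued closed one-manifold. -/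
theorem dist_eq_half_sub_circles (m : ℕ) (a b : NCMatching (2 * m) m) :
    mdist a b + comps a b = m := by
  obtain ⟨d, hd, hseq⟩ := exists_moveSeq a b
  have hle : mdist a b ≤ d := Nat.sInf_le hseq
  obtain ⟨f, hf0, hfl, hf⟩ : mdist a b ∈ {d : ℕ | ∃ f : Fin (d + 1) → NCMatching (2 * m) m,
      f 0 = a ∧ f (Fin.last d) = b ∧ IsMoveSeq f} := Nat.sInf_mem ⟨d, hseq⟩
  have hge := hf.comps_le b (Fin.last _)
  rw [hfl, hf0, comps_self, Fin.val_last] at hge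
  omega
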